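/- Let Q be the 3-dimensional real Leibniz algebra with bracket determined by [g,e]=f and [g,f]=−e (all other brackets of basis vectors zero). A linear map N : Q → Q is a Nijenhuis operator on Q if and only if its matrix (rows = coordinates of N(e), N(f), N(g) in the basis {e,f,g}) has one of the following forms for real parameters: (1) rows (k₁,0,0), (0,k₁,0), (p₁,p₂,k₁); (2) rows (k₁,0,0), (0,k₁,0), (0,0,p₃) with p₃≠k₁; (3) rows (k₁,k₂,0), (−k₂,k₁,0), (0,0,p₃) with k₂≠0. -/

import Mathlib

/-- Bracket of the 3-dim real Leibniz algebra with [g,e]=f, [g,f]=-e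
(basis e,f,g ↔ indices 0,1,2). -/
noncomputable def br (x y : Fin 3 → ℝ) : Fin 3 → ℝ :=
  ![-(x 2 * y 1), x 2 * y 0, 0]

theorem exists_eq_vec_three {α : Type*} (v : Fin 3 → α) : ∃ a b c, v = ![a, b, c] :=
  ⟨v 0, v 1, v 2, by ext i; fin_cases i <;> rfl⟩

theorem map_eq_vec_of_basis (N : (Fin 3 → ℝ) →ₗ[ℝ] (Fin 3 → ℝ))
    {k₁ k₂ k₃ l₁ l₂ l₃ p₁ p₂ p₃ : ℝ} (he : N ![1,0,0] = ![k₁,k₂,k₃])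
    (hf : N ![0,1,0] = ![l₁,l₂,l₃]) (hg : N ![0,0,1] = ![p₁,p₂,p₃]) (v : Fin 3 → ℝ) :
    N v = ![v 0 * k₁ + v 1 * l₁ + v 2 * p₁, v 0 * k₂ + v 1 * l₂ + v 2 * p₂,
      v 0 * k₃ + v 1 * l₃ + v 2 * p₃] := by
  have hv : v = v 0 • ![1,0,0] + v 1 • ![0,1,0] + v 2 • ![0,0,1] := by
    ext i; fin_cases i <;> simp
  conv_lhs => rw [hv, map_add, map_add, map_smul, map_smul, map_smul, he, hf, hg]
  ext i; fin_cases i <;> simp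

theorem nijenhuis_classification_thm2_10 (N : (Fin 3 → ℝ) →ₗ[ℝ] (Fin 3 → ℝ)) :
    (∀ x y, br (N x) (N y) + N (N (br x y)) = N (br (N x) y) + N (br x (N y)))
    ↔
    ((∃ k₁ p₁ p₂ : ℝ,
        N ![1,0,0] = ![k₁,0,0] ∧ N ![0,1,0] = ![0,k₁,0] ∧ N ![0,0,1] = ![p₁,p₂,k₁]) ∨
     (∃ k₁ p₃ : ℝ, p₃ ≠ k₁ ∧
        N ![1,0,0] = ![k₁,0,0] ∧ N ![0,1,0] = ![0,k₁,0] ∧ N ![0,0,1] = ![0,0,p₃]) ∨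
     (∃ k₁ k₂ p₃ : ℝ, k₂ ≠ 0 ∧
        N ![1,0,0] = ![k₁,k₂,0] ∧ N ![0,1,0] = ![-k₂,k₁,0] ∧ N ![0,0,1] = ![0,0,p₃])) := by
  constructor
  · intro h
    obtain ⟨k₁, k₂, k₃, he⟩ := exists_eq_vec_three (N ![1,0,0])
    obtain ⟨l₁, l₂, l₃, hf⟩ := exists_eq_vec_three (N ![0,1,0])
    obtain ⟨p₁, p₂, p₃, hg⟩ := exists_eq_vec_three (N ![0,0,1])
    have hN := map_eq_vec_of_basis N he hf hg
    have hef := h ![1,0,0] ![0,1,0]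
    have hfe := h ![0,1,0] ![1,0,0]
    have hge := h ![0,0,1] ![1,0,0]
    have hgf := h ![0,0,1] ![0,1,0]
    have hgg := h ![0,0,1] ![0,0,1]
    simp only [br, hN] at hef hfe hge hgf hgg
    simp at hef hfe hge hgf hgg
    obtain ⟨-, -, rfl⟩ := hef
    obtain ⟨-, -, rfl⟩ := hfe
    obtain ⟨hge₁, hge₂, -⟩ := hge
    obtain ⟨hgf₁, hgf₂, -⟩ := hgf
    obtain ⟨hgg₁, hgg₂, -⟩ := hgg
    have hl : l₁ * ((l₁ + k₂) ^ 2 + (l₂ - k₁) ^ 2) = 0 := by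
      linear_combination (l₂ - k₁) * hge₁ - (l₁ + k₂) * hgf₁
    have hk : k₂ * ((l₁ + k₂) ^ 2 + (l₂ - k₁) ^ 2) = 0 := by
      linear_combination (l₁ + k₂) * hge₂ + (l₂ - k₁) * hgf₂
    have hk₁ : (k₁ - p₃) * ((l₁ + k₂) ^ 2 + (l₂ - k₁) ^ 2) = 0 := by
      linear_combination (l₁ + k₂) * hge₁ + (l₂ - k₁) * hgf₁
    have hl₂ : (l₂ - p₃) * ((l₁ + k₂) ^ 2 + (l₂ - k₁) ^ 2) = 0 := by
      linear_combination (l₂ - k₁) * hge₂ - (l₁ + k₂) * hgf₂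
    have hsq : (l₁ + k₂) ^ 2 + (l₂ - k₁) ^ 2 = 0 := by
      refine pow_eq_zero_iff two_ne_zero |>.mp ?_
      linear_combination (l₁ + k₂) * (hl + hk) + (l₂ - k₁) * (hl₂ - hk₁)
    obtain rfl : l₁ = -k₂ := by nlinarith [sq_nonneg (l₁ + k₂), sq_nonneg (l₂ - k₁)]
    obtain rfl : l₂ = k₁ := by nlinarith [sq_nonneg (l₂ - k₁)]
    have hp₁ : p₁ * (k₂ ^ 2 + (l₂ - p₃) ^ 2) = 0 := by
      linear_combination k₂ * hgg₁ - (l₂ - p₃) * hgg₂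
    have hp₂ : p₂ * (k₂ ^ 2 + (l₂ - p₃) ^ 2) = 0 := by
      linear_combination (l₂ - p₃) * hgg₁ + k₂ * hgg₂
    by_cases hk₂ : k₂ = 0
    · subst hk₂
      by_cases hp₃ : p₃ = l₂
      · subst hp₃
        exact .inl ⟨p₃, p₁, p₂, he, by simpa using hf, hg⟩
      · have hne : (0 : ℝ) ^ 2 + (l₂ - p₃) ^ 2 ≠ 0 := by
          simpa [sub_eq_zero] using Ne.symm hp₃
        obtain rfl := (mul_eq_zero.mp hp₁).resolve_right hne
        obtain rfl := (mul_eq_zero.mp hp₂).resolve_right hne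
        exact .inr (.inl ⟨l₂, p₃, hp₃, he, by simpa using hf, hg⟩)
    · have hne : k₂ ^ 2 + (l₂ - p₃) ^ 2 ≠ 0 := by positivity
      obtain rfl := (mul_eq_zero.mp hp₁).resolve_right hne
      obtain rfl := (mul_eq_zero.mp hp₂).resolve_right hne
      exact .inr (.inr ⟨l₂, k₂, p₃, hk₂, he, hf, hg⟩)
  · rintro (⟨k₁, p₁, p₂, he, hf, hg⟩ | ⟨k₁, p₃, -, he, hf, hg⟩ | ⟨k₁, k₂, p₃, -, he, hf, hg⟩) <;>
    · intro x y
      simp only [br, map_eq_vec_of_basis N he hf hg]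
      ext i
      fin_cases i <;> simp <;> ring_nf
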